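/- If x is a standard p-dimensional Gaussian vector and A is a p×p real symmetric matrix, then E[(x'Ax)^4] = 48·tr(A⁴) + 32·tr(A³)·tr(A) + 12·(tr(A²))² + 12·tr(A²)·(tr(A))² + (tr(A))⁴. -/

import Mathlib

open MeasureTheory ProbabilityTheory Matrix

noncomputable def stdGaussian (p : ℕ) : Measure (Fin p → ℝ) :=
  Measure.pi fun _ => gaussianReal 0 1

lemma integrable_pow_gaussianReal (μ : ℝ) (v : NNReal) (n : ℕ) :
    Integrable (fun x ↦ x ^ n) (gaussianReal μ v) := by
  have h := (memLp_id_gaussianReal (μ := μ) (v := v) n).integrable_norm_pow'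
  refine (integrable_norm_iff (by fun_prop)).1 ?_
  simpa using h

lemma integrable_gaussianPDFReal_mul_pow (n : ℕ) :
    Integrable (fun x ↦ gaussianPDFReal 0 1 x * x ^ n) := by
  have h := (integrable_rpow_mul_exp_neg_mul_sq (b := 1 / 2) (by norm_num) (s := n)
    (by linarith [n.cast_nonneg (α := ℝ)])).const_mul (√(2 * Real.pi * (1 : NNReal)))⁻¹
  refine h.congr (.of_forall fun x ↦ ?_)
  simp only [gaussianPDFReal, Real.rpow_natCast, NNReal.coe_one]
  ring_nf

lemma hasDerivAt_gaussianPDFReal (x : ℝ) :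
    HasDerivAt (gaussianPDFReal 0 1) (-(x * gaussianPDFReal 0 1 x)) x := by
  have h : HasDerivAt (fun y : ℝ ↦ -(y - 0) ^ 2 / (2 * ((1 : NNReal) : ℝ))) (-x) x := by
    convert! ((((hasDerivAt_id x).sub_const 0).pow 2).neg.div_const
      (2 * ((1 : NNReal) : ℝ))) using 1
    simp only [id_eq, sub_zero, NNReal.coe_one]
    ring
  convert! h.exp.const_mul (√(2 * Real.pi * (1 : NNReal)))⁻¹ using 1
  simp only [gaussianPDFReal]
  ring

lemma integral_pow_add_two_gaussianReal (n : ℕ) :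
    ∫ x, x ^ (n + 2) ∂gaussianReal 0 1 = (n + 1) * ∫ x, x ^ n ∂gaussianReal 0 1 := by
  simp_rw [integral_gaussianReal_eq_integral_smul one_ne_zero, smul_eq_mul]
  have h := integral_mul_deriv_eq_deriv_mul_of_integrable
    (u := fun x : ℝ ↦ x ^ (n + 1)) (u' := fun x ↦ ((n + 1 : ℕ) : ℝ) * x ^ n)
    (v := gaussianPDFReal 0 1) (v' := fun x ↦ -(x * gaussianPDFReal 0 1 x))
    (fun x _ ↦ by simpa using hasDerivAt_pow (n + 1) x) (fun x _ ↦ hasDerivAt_gaussianPDFReal x)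
    ((integrable_gaussianPDFReal_mul_pow (n + 2)).neg.congr (.of_forall fun x ↦ by
      simp only [Pi.neg_apply, Pi.mul_apply]; ring))
    (((integrable_gaussianPDFReal_mul_pow n).const_mul ((n + 1 : ℕ) : ℝ)).congr
      (.of_forall fun x ↦ by simp only [Pi.mul_apply]; ring))
    ((integrable_gaussianPDFReal_mul_pow (n + 1)).congr
      (.of_forall fun x ↦ by simp only [Pi.mul_apply]; ring))
  calc ∫ x, gaussianPDFReal 0 1 x * x ^ (n + 2)
      = -∫ x, x ^ (n + 1) * -(x * gaussianPDFReal 0 1 x) := by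
        rw [← integral_neg]; congr with x; ring
    _ = (n + 1) * ∫ x, gaussianPDFReal 0 1 x * x ^ n := by
        rw [h, neg_neg, ← integral_const_mul]; congr with x; push_cast; ring

lemma integrable_add_pow_prod {α β : Type*} [MeasurableSpace α] [MeasurableSpace β]
    {μ : Measure α} {ν : Measure β} [SFinite μ] [SFinite ν] {f : α → ℝ} {g : β → ℝ}
    (hf : ∀ k, Integrable (fun x ↦ f x ^ k) μ) (hg : ∀ k, Integrable (fun y ↦ g y ^ k) ν) (k : ℕ) :
    Integrable (fun z : α × β ↦ (f z.1 + g z.2) ^ k) (μ.prod ν) := by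
  simp_rw [add_pow]
  exact integrable_finsetSum _ fun i _ ↦ ((hf i).mul_prod (hg (k - i))).mul_const _

lemma integral_add_pow_prod {α β : Type*} [MeasurableSpace α] [MeasurableSpace β]
    {μ : Measure α} {ν : Measure β} [SFinite μ] [SFinite ν] {f : α → ℝ} {g : β → ℝ}
    (hf : ∀ k, Integrable (fun x ↦ f x ^ k) μ) (hg : ∀ k, Integrable (fun y ↦ g y ^ k) ν) (k : ℕ) :
    ∫ z, (f z.1 + g z.2) ^ k ∂(μ.prod ν) =
      ∑ i ∈ Finset.range (k + 1), (∫ x, f x ^ i ∂μ) * (∫ y, g y ^ (k - i) ∂ν) * k.choose i := by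
  simp_rw [add_pow]
  rw [integral_finsetSum _ fun i _ ↦ ((hf i).mul_prod (hg (k - i))).mul_const _]
  refine Finset.sum_congr rfl fun i _ ↦ ?_
  rw [integral_mul_const, integral_prod_mul (fun x ↦ f x ^ i) fun y ↦ g y ^ (k - i)]

lemma integrable_mul_sq_pow_gaussianReal (c : ℝ) (k : ℕ) :
    Integrable (fun x ↦ (c * x ^ 2) ^ k) (gaussianReal 0 1) := by
  simp_rw [mul_pow, ← pow_mul]
  exact (integrable_pow_gaussianReal 0 1 _).const_mul _

lemma measurePreserving_cons_gaussianReal (n : ℕ) :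
    MeasurePreserving (MeasurableEquiv.piFinSuccAbove (fun _ : Fin (n + 1) ↦ ℝ) 0).symm
      ((gaussianReal 0 1).prod (stdGaussian n)) (stdGaussian (n + 1)) :=
  (measurePreserving_piFinSuccAbove (fun _ : Fin (n + 1) ↦ gaussianReal 0 1) 0).symm

lemma sum_mul_sq_cons {n : ℕ} (l : Fin (n + 1) → ℝ) (z : ℝ × (Fin n → ℝ)) :
    ∑ i, l i * (MeasurableEquiv.piFinSuccAbove (fun _ : Fin (n + 1) ↦ ℝ) 0).symm z i ^ 2 =
      l 0 * z.1 ^ 2 + ∑ i, l i.succ * z.2 i ^ 2 := by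
  simp [MeasurableEquiv.piFinSuccAbove_symm_apply, Fin.insertNthEquiv, Fin.sum_univ_succ]

instance (n : ℕ) : IsProbabilityMeasure (stdGaussian n) := by
  unfold _root_.stdGaussian; infer_instance

lemma integrable_sum_mul_sq_pow (n : ℕ) (l : Fin n → ℝ) (k : ℕ) :
    Integrable (fun x ↦ (∑ i, l i * x i ^ 2) ^ k) (stdGaussian n) := by
  induction n generalizing k with
  | zero => simp
  | succ n ih =>
    rw [← (measurePreserving_cons_gaussianReal n).integrable_comp_emb
      (MeasurableEquiv.measurableEmbedding _)]
    simp_rw [Function.comp_def, sum_mul_sq_cons]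
    exact integrable_add_pow_prod (integrable_mul_sq_pow_gaussianReal _) (ih _) k

lemma integral_sum_mul_sq_pow_succ {n : ℕ} (l : Fin (n + 1) → ℝ) (k : ℕ) :
    ∫ x, (∑ i, l i * x i ^ 2) ^ k ∂(stdGaussian (n + 1)) =
      ∑ j ∈ Finset.range (k + 1), l 0 ^ j * (∫ x, x ^ (2 * j) ∂gaussianReal 0 1) *
        (∫ x, (∑ i, l i.succ * x i ^ 2) ^ (k - j) ∂(stdGaussian n)) * k.choose j := by
  rw [← (measurePreserving_cons_gaussianReal n).integral_comp']
  simp_rw [sum_mul_sq_cons]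
  rw [integral_add_pow_prod (integrable_mul_sq_pow_gaussianReal _)
    (integrable_sum_mul_sq_pow n fun i ↦ l i.succ) k]
  simp_rw [mul_pow, ← pow_mul, integral_const_mul]

/-- The first four moments of a weighted sum of independent `χ²₁` variables. -/
lemma moments_sum_mul_sq (n : ℕ) (l : Fin n → ℝ) :
    ∫ x, (∑ i, l i * x i ^ 2) ^ 1 ∂(stdGaussian n) = ∑ i, l i ∧
    ∫ x, (∑ i, l i * x i ^ 2) ^ 2 ∂(stdGaussian n) = 2 * ∑ i, l i ^ 2 + (∑ i, l i) ^ 2 ∧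
    ∫ x, (∑ i, l i * x i ^ 2) ^ 3 ∂(stdGaussian n) =
      8 * ∑ i, l i ^ 3 + 6 * (∑ i, l i ^ 2) * ∑ i, l i + (∑ i, l i) ^ 3 ∧
    ∫ x, (∑ i, l i * x i ^ 2) ^ 4 ∂(stdGaussian n) =
      48 * ∑ i, l i ^ 4 + 32 * (∑ i, l i ^ 3) * ∑ i, l i + 12 * (∑ i, l i ^ 2) ^ 2 +
        12 * (∑ i, l i ^ 2) * (∑ i, l i) ^ 2 + (∑ i, l i) ^ 4 := by
  induction n with
  | zero => simp
  | succ n ih =>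
    obtain ⟨h1, h2, h3, h4⟩ := ih fun i ↦ l i.succ
    have m0 : ∫ x, x ^ 0 ∂gaussianReal 0 1 = 1 := by simp
    have m2 : ∫ x, x ^ 2 ∂gaussianReal 0 1 = 1 := by
      rw [integral_pow_add_two_gaussianReal 0, m0]; norm_num
    have m4 : ∫ x, x ^ 4 ∂gaussianReal 0 1 = 3 := by
      rw [integral_pow_add_two_gaussianReal 2, m2]; norm_num
    have m6 : ∫ x, x ^ 6 ∂gaussianReal 0 1 = 15 := by
      rw [integral_pow_add_two_gaussianReal 4, m4]; norm_num
    have m8 : ∫ x, x ^ 8 ∂gaussianReal 0 1 = 105 := by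
      rw [integral_pow_add_two_gaussianReal 6, m6]; norm_num
    have h0 : ∫ x, (∑ i, l i.succ * x i ^ 2) ^ 0 ∂(stdGaussian n) = 1 := by simp
    have c42 : Nat.choose 4 2 = 6 := rfl
    have c43 : Nat.choose 4 3 = 4 := rfl
    have c32 : Nat.choose 3 2 = 3 := rfl
    refine ⟨?_, ?_, ?_, ?_⟩ <;>
    · rw [integral_sum_mul_sq_pow_succ]
      simp only [Finset.sum_range_succ, Finset.sum_range_zero, Nat.reduceMul, Nat.reduceSub,
        m0, m2, m4, m6, m8, h0, h1, h2, h3, h4, Fin.sum_univ_succ, Nat.choose_self,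
        Nat.choose_one_right, Nat.choose_zero_right, c42, c43, c32]
      push_cast
      ring

/-- The standard Gaussian measure is invariant under a change of orthonormal basis. -/
lemma integral_stdGaussian_eq_orthonormalBasis {p : ℕ}
    (b : OrthonormalBasis (Fin p) ℝ (EuclideanSpace ℝ (Fin p))) {f : (Fin p → ℝ) → ℝ}
    (hf : Continuous f) :
    ∫ x, f x ∂(stdGaussian p) = ∫ x, f (∑ i, x i • b i).ofLp ∂(stdGaussian p) := by
  have h := (map_pi_eq_stdGaussian (ι := Fin p)).trans (stdGaussian_eq_map_pi_orthonormalBasis b)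
  have h' := congrArg (fun μ ↦ ∫ y, f y.ofLp ∂μ) h
  have hc : Continuous fun y : EuclideanSpace ℝ (Fin p) ↦ f y.ofLp := by fun_prop
  have hb : Continuous fun x : Fin p → ℝ ↦ ∑ i, x i • b i := by fun_prop
  simp only at h'
  rwa [integral_map (by fun_prop) hc.aestronglyMeasurable,
    integral_map hb.measurable.aemeasurable hc.aestronglyMeasurable] at h'

lemma dotProduct_mulVec_sum_eigenvectorBasis {n : Type*} [Fintype n] [DecidableEq n]
    {A : Matrix n n ℝ} (hA : A.IsHermitian) (x : n → ℝ) :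
    (∑ i, x i • hA.eigenvectorBasis i).ofLp ⬝ᵥ A *ᵥ (∑ i, x i • hA.eigenvectorBasis i).ofLp =
      ∑ i, hA.eigenvalues i * x i ^ 2 := by
  have h (i j : n) : (hA.eigenvectorBasis i).ofLp ⬝ᵥ (hA.eigenvectorBasis j).ofLp =
      if i = j then 1 else 0 := by
    rw [← orthonormal_iff_ite.1 hA.eigenvectorBasis.orthonormal i j,
      EuclideanSpace.inner_eq_star_dotProduct, dotProduct_comm]
    simp
  simp only [WithLp.ofLp_sum, WithLp.ofLp_smul, mulVec_sum, mulVec_smul,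
    hA.mulVec_eigenvectorBasis, sum_dotProduct, dotProduct_sum, smul_dotProduct, dotProduct_smul, h]
  simp
  refine Finset.sum_congr rfl fun i _ ↦ by ring

lemma trace_pow_eq_sum_eigenvalues_pow {n : Type*} [Fintype n] [DecidableEq n]
    {A : Matrix n n ℝ} (hA : A.IsHermitian) (k : ℕ) :
    (A ^ k).trace = ∑ i, hA.eigenvalues i ^ k := by
  conv_lhs => rw [hA.spectral_theorem, ← map_pow, Unitary.conjStarAlgAut_apply, trace_mul_comm,
    ← mul_assoc]
  simp [diagonal_pow, trace_diagonal]

/-- If `x ~ N_p(0, I_p)` and `A` is symmetric, then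
`E[(x'Ax)^4] = 48 tr(A⁴) + 32 tr(A³) tr(A) + 12 (tr A²)² + 12 tr(A²)(tr A)² + (tr A)⁴`. -/
theorem fourth_moment_quadratic_form (p : ℕ) (A : Matrix (Fin p) (Fin p) ℝ)
    (hA : A.IsSymm) :
    ∫ x, (x ⬝ᵥ A.mulVec x) ^ 4 ∂(stdGaussian p)
      = 48 * (A * A * A * A).trace + 32 * (A * A * A).trace * A.trace
        + 12 * (A * A).trace ^ 2 + 12 * (A * A).trace * A.trace ^ 2
        + A.trace ^ 4 := by
  have hH : A.IsHermitian := by rwa [IsHermitian, conjTranspose_eq_transpose_of_trivial]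
  rw [integral_stdGaussian_eq_orthonormalBasis hH.eigenvectorBasis (by fun_prop)]
  simp_rw [dotProduct_mulVec_sum_eigenvectorBasis]
  rw [(moments_sum_mul_sq p hH.eigenvalues).2.2.2]
  have h1 := trace_pow_eq_sum_eigenvalues_pow hH 1
  simp only [pow_one] at h1
  simp only [← pow_two, ← pow_succ, Nat.reduceAdd, trace_pow_eq_sum_eigenvalues_pow hH, h1]
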